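/- For all 1 ≤ m ≤ n, the number of rooted labeled forests on [n] avoiding both 312 and 213 (unimodal forests) that consist of exactly m trees equals ∑_{k=m}^{n} c(k,m)·c(n,k), where c(n,k) is the unsigned Stirling number of the first kind. -/

import Mathlib

/-- A rooted labeled forest on `[n]`, encoded as a parent function
`p : Fin n → Option (Fin n)` (`p v = none` means `v` is a root).
Acyclicity is expressed by the existence of a depth function strictly
decreasing from each vertex to its parent. -/
def IsForest {n : ℕ} (p : Fin n → Option (Fin n)) : Prop :=
  ∃ d : Fin n → ℕ, ∀ v w : Fin n, p v = some w → d w < d v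

/-- `StrictAnc p a b` means `a` is a strict ancestor of `b` in the forest `p`. -/
def StrictAnc {n : ℕ} (p : Fin n → Option (Fin n)) (a b : Fin n) : Prop :=
  Relation.TransGen (fun x y : Fin n => p y = some x) a b

/-- The forest `p` contains the pattern `σ` (given in one-line notation):
there is a chain of vertices along some root-to-vertex path whose labels
are order-isomorphic to `σ`. -/
def ForestContains {n : ℕ} (p : Fin n → Option (Fin n)) (σ : List ℕ) : Prop :=
  ∃ u : Fin σ.length → Fin n,
    (∀ i j : Fin σ.length, i < j → StrictAnc p (u i) (u j)) ∧
    (∀ i j : Fin σ.length, σ.get i < σ.get j ↔ u i < u j)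

/-- The forest `p` avoids the pattern `σ`. -/
def ForestAvoids {n : ℕ} (p : Fin n → Option (Fin n)) (σ : List ℕ) : Prop :=
  ¬ ForestContains p σ

/-- Number of cycles (including fixed points) in the cycle decomposition of a
permutation. -/
def permNumCycles {n : ℕ} (π : Equiv.Perm (Fin n)) : ℕ :=
  π.cycleType.card + (Finset.univ.filter fun x => π x = x).card

/-- Unsigned Stirling number of the first kind: the number of permutations of
`[n]` with exactly `k` cycles. -/
noncomputable def stirlingFirst (n k : ℕ) : ℕ :=
  Nat.card {π : Equiv.Perm (Fin n) // permNumCycles π = k}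

/-- Stirling number of the second kind: the number of partitions of `[n]`
into `k` nonempty subsets. -/
noncomputable def stirlingSecond (n k : ℕ) : ℕ :=
  Nat.card {P : Finpartition (Finset.univ : Finset (Fin n)) // P.parts.card = k}

/-- The Bell number: the number of set partitions of `[n]`. -/
noncomputable def bellNumber (n : ℕ) : ℕ :=
  Nat.card (Finpartition (Finset.univ : Finset (Fin n)))

/-- A vertex is a top-down maximum if it is larger than all of its ancestors. -/
def IsTopDownMax {n : ℕ} (p : Fin n → Option (Fin n)) (v : Fin n) : Prop :=
  ∀ u : Fin n, StrictAnc p u v → u < v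

open Polynomial

/-- The Boolean colourings that are constant along the cycles of `π`. -/
def invariantColorings {α : Type*} [Fintype α] [DecidableEq α] (π : Equiv.Perm α) :
    Finset (α → Bool) :=
  Finset.univ.filter fun f => ∀ x, f (π x) = f x

theorem card_quotient_sameCycle {α : Type*} [Fintype α] [DecidableEq α] (π : Equiv.Perm α) :
    Nat.card (Quotient (Equiv.Perm.SameCycle.setoid π)) =
      π.cycleType.card + (Finset.univ.filter fun x => π x = x).card := by
  classical
  let key : α → Equiv.Perm α ⊕ α := fun x => if π x = x then Sum.inr x else Sum.inl (π.cycleOf x)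
  have hkey : ∀ x y, π.SameCycle x y ↔ key x = key y := by
    intro x y
    by_cases hx : π x = x
    · by_cases hy : π y = y
      · simp only [key, hx, hy, if_true, Sum.inr.injEq]
        refine ⟨fun h => h.eq_of_left hx, ?_⟩
        rintro rfl
        exact Equiv.Perm.SameCycle.refl _ _
      · simp only [key, hx, hy, if_true, if_false, reduceCtorEq, iff_false]
        exact fun h => hy (h.apply_eq_self_iff.1 hx)
    · by_cases hy : π y = y
      · simp only [key, hx, hy, if_true, if_false, reduceCtorEq, iff_false]
        exact fun h => hx (h.apply_eq_self_iff.2 hy)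
      · simp only [key, hx, hy, if_false, Sum.inl.injEq]
        exact Equiv.Perm.sameCycle_iff_cycleOf_eq_of_mem_support
          (Equiv.Perm.mem_support.2 hx) (Equiv.Perm.mem_support.2 hy)
  have himage : Finset.univ.image key =
      π.cycleFactorsFinset.disjSum (Finset.univ.filter fun x => π x = x) := by
    ext (c | x)
    · simp only [Finset.mem_image, Finset.mem_univ, true_and, Finset.inl_mem_disjSum]
      constructor
      · rintro ⟨x, hx⟩
        by_cases h : π x = x
        · simp [key, h] at hx
        · simp only [key, h, if_false, Sum.inl.injEq] at hx
          rw [← hx, Equiv.Perm.cycleOf_mem_cycleFactorsFinset_iff, Equiv.Perm.mem_support]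
          exact h
      · intro hc
        obtain ⟨x, hx⟩ := (Equiv.Perm.mem_cycleFactorsFinset_iff.1 hc).1.nonempty_support
        have hxπ : π x ≠ x :=
          Equiv.Perm.mem_support.1 (Equiv.Perm.mem_cycleFactorsFinset_support_le hc hx)
        exact ⟨x, by simp [key, hxπ, Equiv.Perm.cycle_is_cycleOf hx hc]⟩
    · simp only [Finset.mem_image, Finset.mem_univ, true_and, Finset.inr_mem_disjSum,
        Finset.mem_filter]
      constructor
      · rintro ⟨y, hy⟩
        by_cases h : π y = y
        · simp only [key, h, if_true, Sum.inr.injEq] at hy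
          exact hy ▸ h
        · simp [key, h] at hy
      · exact fun h => ⟨x, by simp [key, h]⟩
  have hcard : Nat.card (Quotient (Equiv.Perm.SameCycle.setoid π)) = Nat.card (Set.range key) := by
    have e : Equiv.Perm.SameCycle.setoid π = Setoid.ker key := Setoid.ext hkey
    rw [e]
    exact Nat.card_congr (Setoid.quotientKerEquivRange key)
  rw [hcard, Nat.card_coe_set_eq, ← Set.image_univ, ← Finset.coe_univ, ← Finset.coe_image,
    Set.ncard_coe_finset, himage, Finset.card_disjSum, Equiv.Perm.cycleType_def]
  simp

theorem card_invariantColorings {n : ℕ} (π : Equiv.Perm (Fin n)) :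
    (invariantColorings π).card = 2 ^ permNumCycles π := by
  classical
  have hinv : ∀ f : Fin n → Bool, (∀ x, f (π x) = f x) → ∀ x y, π.SameCycle x y → f x = f y := by
    intro f hf x y h
    obtain ⟨i, -, rfl⟩ := h.exists_pow_eq'
    induction i with
    | zero => simp
    | succ i ih => rw [pow_succ', Equiv.Perm.mul_apply, hf]; exact ih ⟨i, by simp⟩
  let e : {f : Fin n → Bool // ∀ x, f (π x) = f x} ≃
      (Quotient (Equiv.Perm.SameCycle.setoid π) → Bool) :=
    { toFun := fun f q => Quotient.lift f.1 (hinv f.1 f.2) q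
      invFun := fun g => ⟨fun x => g (Quotient.mk _ x), fun x =>
        congrArg g (Quotient.sound (Equiv.Perm.sameCycle_apply_left.2
          (Equiv.Perm.SameCycle.refl π x)))⟩
      left_inv := fun f => rfl
      right_inv := fun g => by
        ext q
        induction q using Quotient.inductionOn
        rfl }
  rw [permNumCycles, ← card_quotient_sameCycle, invariantColorings, ← Fintype.card_subtype,
    ← Nat.card_eq_fintype_card, Nat.card_congr e, Nat.card_fun]
  simp

theorem permNumCycles_decomposeFin_symm_zero {n : ℕ} (e : Equiv.Perm (Fin n)) :
    permNumCycles (Equiv.Perm.decomposeFin.symm (0, e)) = permNumCycles e + 1 := by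
  apply Nat.pow_right_injective le_rfl
  change 2 ^ _ = 2 ^ _
  rw [pow_succ, ← card_invariantColorings, ← card_invariantColorings, ← Fintype.card_bool,
    ← Finset.card_univ, ← Finset.card_product]
  refine Finset.card_nbij' (fun f => (fun i => f i.succ, f 0))
    (fun g => Fin.cons g.2 g.1) ?_ ?_ ?_ ?_
  · intro f hf
    simp [invariantColorings, Fin.forall_fin_succ] at hf ⊢
    exact hf
  · intro f hf
    simp [invariantColorings, Fin.forall_fin_succ] at hf ⊢
    exact hf
  · intro f _
    exact Fin.cons_self_tail f
  · intro f _
    simp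

theorem permNumCycles_decomposeFin_symm_succ {n : ℕ} (w : Fin n) (e : Equiv.Perm (Fin n)) :
    permNumCycles (Equiv.Perm.decomposeFin.symm (w.succ, e)) = permNumCycles e := by
  apply Nat.pow_right_injective le_rfl
  change 2 ^ _ = 2 ^ _
  have hswap : ∀ f : Fin (n + 1) → Bool, f w.succ = f 0 → ∀ x, f (Equiv.swap 0 w.succ x) = f x := by
    intro f h x
    rw [Equiv.swap_apply_def]
    split_ifs with h0 h1
    · rw [h0, h]
    · rw [h1, h]
    · rfl
  rw [← card_invariantColorings, ← card_invariantColorings]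
  refine Finset.card_nbij' (fun f i => f i.succ)
    (fun g => Fin.cons (g w) g) ?_ ?_ ?_ ?_
  · intro f hf
    simp only [invariantColorings, Fin.forall_fin_succ, Finset.coe_filter, Finset.mem_univ,
      true_and, Set.mem_ofPred_eq, Equiv.Perm.decomposeFin_symm_apply_zero,
      Equiv.Perm.decomposeFin_symm_apply_succ] at hf ⊢
    intro i
    rw [← hf.2 i, hswap f hf.1]
  · intro g hg
    simp only [invariantColorings, Fin.forall_fin_succ, Finset.coe_filter, Finset.mem_univ,
      true_and, Set.mem_ofPred_eq, Equiv.Perm.decomposeFin_symm_apply_zero,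
      Equiv.Perm.decomposeFin_symm_apply_succ] at hg ⊢
    refine ⟨by simp, fun i => ?_⟩
    rw [hswap (Fin.cons (g w) g) (by simp)]
    simpa using hg i
  · intro f hf
    simp only [invariantColorings, Fin.forall_fin_succ, Finset.coe_filter, Finset.mem_univ,
      true_and, Set.mem_ofPred_eq, Equiv.Perm.decomposeFin_symm_apply_zero] at hf
    simp only [hf.1]
    exact Fin.cons_self_tail f
  · intro f _
    simp

theorem sum_perm_permNumCycles_succ {M : Type*} [AddCommMonoid M] (n : ℕ) (f : ℕ → M) :
    ∑ π : Equiv.Perm (Fin (n + 1)), f (permNumCycles π) =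
      ∑ π : Equiv.Perm (Fin n), (f (permNumCycles π + 1) + n • f (permNumCycles π)) := by
  rw [← Equiv.Perm.decomposeFin.symm.sum_comp, Fintype.sum_prod_type, Fin.sum_univ_succ,
    Finset.sum_add_distrib]
  simp [permNumCycles_decomposeFin_symm_zero, permNumCycles_decomposeFin_symm_succ,
    Finset.smul_sum]

theorem permNumCycles_fin_zero (π : Equiv.Perm (Fin 0)) : permNumCycles π = 0 := by
  simp [permNumCycles, Subsingleton.elim π 1]

theorem permNumCycles_le {n : ℕ} (π : Equiv.Perm (Fin n)) : permNumCycles π ≤ n := by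
  rw [permNumCycles, ← card_quotient_sameCycle]
  exact (Nat.card_le_card_of_surjective _ Quotient.mk_surjective).trans (by simp)

theorem sum_X_pow_permNumCycles (n : ℕ) :
    ∑ π : Equiv.Perm (Fin n), (X : ℕ[X]) ^ permNumCycles π = ascPochhammer ℕ n := by
  induction n with
  | zero => simp [permNumCycles_fin_zero]
  | succ n ih =>
    rw [sum_perm_permNumCycles_succ n fun k => (X : ℕ[X]) ^ k, ascPochhammer_succ_right, ← ih,
      Finset.sum_mul]
    refine Finset.sum_congr rfl fun π _ => ?_
    rw [nsmul_eq_mul]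
    ring

theorem stirlingFirst_eq_card_filter (n k : ℕ) :
    stirlingFirst n k =
      (Finset.univ.filter fun π : Equiv.Perm (Fin n) => permNumCycles π = k).card := by
  rw [stirlingFirst, Nat.card_eq_fintype_card, Fintype.card_subtype]

theorem coeff_ascPochhammer_eq_stirlingFirst (n k : ℕ) :
    (ascPochhammer ℕ n).coeff k = stirlingFirst n k := by
  rw [← sum_X_pow_permNumCycles, finsetSum_coeff, stirlingFirst_eq_card_filter,
    Finset.card_filter]
  simp only [coeff_X_pow, eq_comm]

theorem stirlingFirst_eq_zero_of_lt {n k : ℕ} (h : n < k) : stirlingFirst n k = 0 := by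
  rw [stirlingFirst_eq_card_filter, Finset.card_eq_zero, Finset.filter_eq_empty_iff]
  exact fun π _ hπ => absurd (permNumCycles_le π) (by omega)

theorem coeff_sum_ascPochhammer_permNumCycles (n m : ℕ) :
    (∑ π : Equiv.Perm (Fin n), ascPochhammer ℕ (permNumCycles π)).coeff m =
      ∑ k ∈ Finset.Icc m n, stirlingFirst k m * stirlingFirst n k := by
  simp only [finsetSum_coeff, coeff_ascPochhammer_eq_stirlingFirst]
  rw [← Finset.sum_fiberwise_of_maps_to (t := Finset.range (n + 1)) (g := permNumCycles)
    fun π _ => Finset.mem_range_succ_iff.2 (permNumCycles_le π)]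
  symm
  refine Finset.sum_subset_zero_on_sdiff ?_ ?_ ?_
  · intro k hk
    simp only [Finset.mem_Icc, Finset.mem_range] at hk ⊢
    omega
  · intro k hk
    simp only [Finset.mem_sdiff, Finset.mem_range, Finset.mem_Icc, not_and, not_le] at hk
    refine Finset.sum_eq_zero fun π hπ => ?_
    rw [(Finset.mem_filter.1 hπ).2]
    exact stirlingFirst_eq_zero_of_lt (by omega)
  · intro k _
    rw [Finset.sum_congr rfl fun π hπ => by rw [(Finset.mem_filter.1 hπ).2], Finset.sum_const,
      ← stirlingFirst_eq_card_filter, smul_eq_mul, mul_comm]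

/-- The vertices of a parent function that have no parent. -/
def forestRoots {n : ℕ} (p : Fin n → Option (Fin n)) : Finset (Fin n) :=
  Finset.univ.filter fun v => p v = none

/-- A parent function is unimodal if it has no cycle and the labels never go down and then up
along a path away from a root. -/
def IsUnimodal {n : ℕ} (p : Fin n → Option (Fin n)) : Prop :=
  (∀ a, ¬ StrictAnc p a a) ∧ ∀ a b c, StrictAnc p a b → StrictAnc p b c → b < a → ¬ b < c

theorem isForest_iff {n : ℕ} (p : Fin n → Option (Fin n)) :
    IsForest p ↔ ∀ a, ¬ StrictAnc p a a := by
  classical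
  constructor
  · rintro ⟨d, hd⟩ a ha
    have : ∀ x y, StrictAnc p x y → d x < d y := by
      intro x y h
      induction h with
      | single h => exact hd _ _ h
      | tail _ h ih => exact ih.trans (hd _ _ h)
    exact lt_irrefl _ (this a a ha)
  · intro h
    refine ⟨fun v => (Finset.univ.filter fun u => StrictAnc p u v).card, fun v w hvw => ?_⟩
    have hwv : StrictAnc p w v := Relation.TransGen.single hvw
    refine Finset.card_lt_card ⟨fun u hu => ?_, fun hs => ?_⟩
    · simp only [Finset.mem_filter, Finset.mem_univ, true_and] at hu ⊢
      exact hu.trans hwv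
    · exact h w (by simpa using hs (by simpa using hwv))

theorem isUnimodal_iff {n : ℕ} (p : Fin n → Option (Fin n)) :
    IsUnimodal p ↔
      IsForest p ∧ ForestAvoids p [3, 1, 2] ∧ ForestAvoids p [2, 1, 3] := by
  rw [isForest_iff]
  constructor
  · rintro ⟨h1, h2⟩
    refine ⟨h1, ?_, ?_⟩
    · rintro ⟨u, hu, hlt⟩
      exact h2 (u 0) (u 1) (u 2) (hu 0 1 (by decide)) (hu 1 2 (by decide))
        ((hlt 1 0).1 (by decide)) ((hlt 1 2).1 (by decide))
    · rintro ⟨u, hu, hlt⟩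
      exact h2 (u 0) (u 1) (u 2) (hu 0 1 (by decide)) (hu 1 2 (by decide))
        ((hlt 1 0).1 (by decide)) ((hlt 1 2).1 (by decide))
  · rintro ⟨h1, h2, h3⟩
    refine ⟨h1, fun a b c hab hbc hba hbc' => ?_⟩
    have hchain : ∀ i j : Fin 3, i < j → StrictAnc p (![a, b, c] i) (![a, b, c] j) := by
      intro i j hij
      fin_cases i <;> fin_cases j <;> simp at hij ⊢
      · exact hab
      · exact hab.trans hbc
      · exact hbc
    rcases lt_trichotomy a c with hac | hac | hac
    · refine h3 ⟨![a, b, c], hchain, fun i j => ?_⟩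
      fin_cases i <;> fin_cases j <;> simp [hba, hbc', hac, hba.le, hbc'.le, hac.le]
    · exact h1 a (hac ▸ hab.trans hbc)
    · refine h2 ⟨![a, b, c], hchain, fun i j => ?_⟩
      fin_cases i <;> fin_cases j <;> simp [hba, hbc', hac, hba.le, hbc'.le, hac.le]

/-- Delete the smallest vertex; its children become roots. -/
def deleteMin {n : ℕ} (q : Fin (n + 1) → Option (Fin (n + 1))) (i : Fin n) : Option (Fin n) :=
  (q i.succ).bind fun j => Fin.cases none some j

/-- Insert a new smallest vertex as a child of `w`. -/
def insertLeaf {n : ℕ} (p : Fin n → Option (Fin n)) (w : Fin n) :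
    Fin (n + 1) → Option (Fin (n + 1)) :=
  Fin.cons (some w.succ) fun i => (p i).map Fin.succ

/-- Insert a new smallest vertex as a root whose children are the vertices in `S`. -/
def insertRoot {n : ℕ} (p : Fin n → Option (Fin n)) (S : Finset (Fin n)) :
    Fin (n + 1) → Option (Fin (n + 1)) :=
  Fin.cons none fun i => if i ∈ S then some 0 else (p i).map Fin.succ

theorem deleteMin_eq_some {n : ℕ} (q : Fin (n + 1) → Option (Fin (n + 1))) (i j : Fin n) :
    deleteMin q i = some j ↔ q i.succ = some j.succ := by
  rw [deleteMin]
  rcases q i.succ with _ | x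
  · simp
  · cases x using Fin.cases <;> simp [(Fin.succ_ne_zero _).symm]

theorem deleteMin_eq_none {n : ℕ} (q : Fin (n + 1) → Option (Fin (n + 1))) (i : Fin n) :
    deleteMin q i = none ↔ q i.succ = none ∨ q i.succ = some 0 := by
  rw [deleteMin]
  rcases q i.succ with _ | x
  · simp
  · cases x using Fin.cases <;> simp

theorem not_strictAnc_of_eq_none {n : ℕ} {p : Fin n → Option (Fin n)} {a b : Fin n}
    (hb : p b = none) : ¬ StrictAnc p a b := by
  intro h
  obtain ⟨c, -, hc⟩ := Relation.TransGen.tail'_iff.1 h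
  simp [hb] at hc

theorem not_strictAnc_of_forall_ne {n : ℕ} {p : Fin n → Option (Fin n)} {a b : Fin n}
    (ha : ∀ v, p v ≠ some a) : ¬ StrictAnc p a b := by
  intro h
  obtain ⟨c, hc, -⟩ := Relation.TransGen.head'_iff.1 h
  exact ha c hc

theorem strictAnc_succ_of_deleteMin {n : ℕ} {q : Fin (n + 1) → Option (Fin (n + 1))} {a b : Fin n}
    (h : StrictAnc (deleteMin q) a b) : StrictAnc q a.succ b.succ :=
  Relation.TransGen.lift Fin.succ (fun x y => (deleteMin_eq_some q y x).1) _ _ h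

theorem strictAnc_deleteMin_of_succ {n : ℕ} {q : Fin (n + 1) → Option (Fin (n + 1))}
    (hq : q 0 = none ∨ ∀ v, q v ≠ some 0) {a b : Fin n} (h : StrictAnc q a.succ b.succ) :
    StrictAnc (deleteMin q) a b := by
  generalize hx : b.succ = x at h
  induction h generalizing b with
  | single h =>
    subst hx
    exact Relation.TransGen.single ((deleteMin_eq_some q b a).2 h)
  | @tail y _ hy h ih =>
    subst hx
    cases y using Fin.cases with
    | zero =>
      rcases hq with hq | hq
      · exact absurd hy (not_strictAnc_of_eq_none hq)
      · exact absurd h (hq _)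
    | succ y => exact (ih rfl).tail ((deleteMin_eq_some q b y).2 h)

theorem IsUnimodal.zero_root_or_leaf {n : ℕ} {q : Fin (n + 1) → Option (Fin (n + 1))}
    (h : IsUnimodal q) : q 0 = none ∨ ∀ v, q v ≠ some 0 := by
  by_contra! hq
  obtain ⟨h0, v, hv⟩ := hq
  obtain ⟨a, ha⟩ := Option.ne_none_iff_exists'.1 h0
  have ha' : StrictAnc q a 0 := Relation.TransGen.single ha
  have hv' : StrictAnc q 0 v := Relation.TransGen.single hv
  refine h.2 a 0 v ha' hv' (Fin.pos_iff_ne_zero.2 ?_) (Fin.pos_iff_ne_zero.2 ?_)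
  · rintro rfl
    exact h.1 _ ha'
  · rintro rfl
    exact h.1 _ hv'

theorem isUnimodal_deleteMin_iff {n : ℕ} {q : Fin (n + 1) → Option (Fin (n + 1))}
    (hq : q 0 = none ∨ ∀ v, q v ≠ some 0) : IsUnimodal (deleteMin q) ↔ IsUnimodal q := by
  have hcycle : ∀ a b, StrictAnc q a 0 → ¬ StrictAnc q 0 b := by
    intro a b ha hb
    rcases hq with hq | hq
    · exact not_strictAnc_of_eq_none hq ha
    · exact not_strictAnc_of_forall_ne hq hb
  constructor
  · rintro ⟨h1, h2⟩
    constructor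
    · intro a ha
      cases a using Fin.cases with
      | zero => exact hcycle _ _ ha ha
      | succ a => exact h1 a (strictAnc_deleteMin_of_succ hq ha)
    · intro a b c hab hbc hba hbc'
      obtain ⟨a, rfl⟩ := Fin.exists_succ_eq.2 (Fin.pos_iff_ne_zero.1 (b.zero_le.trans_lt hba))
      obtain ⟨c, rfl⟩ := Fin.exists_succ_eq.2 (Fin.pos_iff_ne_zero.1 (b.zero_le.trans_lt hbc'))
      cases b using Fin.cases with
      | zero => exact hcycle _ _ hab hbc
      | succ b =>
        exact h2 a b c (strictAnc_deleteMin_of_succ hq hab) (strictAnc_deleteMin_of_succ hq hbc)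
          (Fin.succ_lt_succ_iff.1 hba) (Fin.succ_lt_succ_iff.1 hbc')
  · rintro ⟨h1, h2⟩
    exact ⟨fun a ha => h1 _ (strictAnc_succ_of_deleteMin ha), fun a b c hab hbc hba hbc' =>
      h2 _ _ _ (strictAnc_succ_of_deleteMin hab) (strictAnc_succ_of_deleteMin hbc)
        (Fin.succ_lt_succ_iff.2 hba) (Fin.succ_lt_succ_iff.2 hbc')⟩

theorem deleteMin_insertLeaf {n : ℕ} (p : Fin n → Option (Fin n)) (w : Fin n) :
    deleteMin (insertLeaf p w) = p := by
  ext1 i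
  rcases h : p i with _ | j <;> simp [deleteMin, insertLeaf, h]

theorem deleteMin_insertRoot {n : ℕ} {p : Fin n → Option (Fin n)} {S : Finset (Fin n)}
    (hS : S ⊆ forestRoots p) : deleteMin (insertRoot p S) = p := by
  ext1 i
  by_cases hi : i ∈ S
  · have : p i = none := by simpa [forestRoots] using hS hi
    simp [deleteMin, insertRoot, hi, this]
  · rcases h : p i with _ | j <;> simp [deleteMin, insertRoot, hi, h]

theorem insertLeaf_deleteMin {n : ℕ} {q : Fin (n + 1) → Option (Fin (n + 1))}
    (hq : ∀ v, q v ≠ some 0) {w : Fin n} (hw : q 0 = some w.succ) :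
    insertLeaf (deleteMin q) w = q := by
  ext1 i
  cases i using Fin.cases with
  | zero => simp [insertLeaf, hw]
  | succ i =>
    rcases h : q i.succ with _ | x
    · simp [insertLeaf, deleteMin, h]
    · cases x using Fin.cases with
      | zero => exact absurd h (hq _)
      | succ x => simp [insertLeaf, deleteMin, h]

theorem insertRoot_deleteMin {n : ℕ} {q : Fin (n + 1) → Option (Fin (n + 1))} (hq : q 0 = none) :
    insertRoot (deleteMin q) (Finset.univ.filter fun i => q i.succ = some 0) = q := by
  ext1 i
  cases i using Fin.cases with
  | zero => simp [insertRoot, hq]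
  | succ i =>
    rcases h : q i.succ with _ | x
    · simp [insertRoot, deleteMin, h]
    · cases x using Fin.cases <;> simp [insertRoot, deleteMin, h]

theorem isUnimodal_insertLeaf {n : ℕ} {p : Fin n → Option (Fin n)} (hp : IsUnimodal p)
    (w : Fin n) : IsUnimodal (insertLeaf p w) := by
  rw [← isUnimodal_deleteMin_iff, deleteMin_insertLeaf]
  · exact hp
  · right
    intro v
    cases v using Fin.cases <;> simp [insertLeaf]

theorem isUnimodal_insertRoot {n : ℕ} {p : Fin n → Option (Fin n)} (hp : IsUnimodal p)
    {S : Finset (Fin n)} (hS : S ⊆ forestRoots p) : IsUnimodal (insertRoot p S) := by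
  rw [← isUnimodal_deleteMin_iff (Or.inl rfl), deleteMin_insertRoot hS]
  exact hp

theorem card_forestRoots_insertLeaf {n : ℕ} (p : Fin n → Option (Fin n)) (w : Fin n) :
    (forestRoots (insertLeaf p w)).card = (forestRoots p).card := by
  rw [forestRoots, Fin.card_filter_univ_succ]
  simp [insertLeaf, forestRoots]

theorem card_forestRoots_insertRoot {n : ℕ} {p : Fin n → Option (Fin n)} {S : Finset (Fin n)}
    (hS : S ⊆ forestRoots p) :
    (forestRoots (insertRoot p S)).card = (forestRoots p).card - S.card + 1 := by
  rw [forestRoots, Fin.card_filter_univ_succ, ← Finset.card_sdiff_of_subset hS]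
  simp only [insertRoot, Fin.cons_zero, if_true, Fin.cons_succ]
  congr 2
  ext i
  by_cases hi : i ∈ S <;> simp [hi, forestRoots]

open Classical in
/-- The unimodal forests on `n` vertices. -/
noncomputable def unimodalForests (n : ℕ) : Finset (Fin n → Option (Fin n)) :=
  Finset.univ.filter IsUnimodal

theorem mem_unimodalForests {n : ℕ} {p : Fin n → Option (Fin n)} :
    p ∈ unimodalForests n ↔ IsUnimodal p := by
  simp [unimodalForests]

theorem sum_unimodalForests_leaf {M : Type*} [AddCommMonoid M] (n : ℕ) (f : ℕ → M) :
    ∑ q ∈ (unimodalForests (n + 1)).filter (fun q => ¬ q 0 = none), f (forestRoots q).card =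
      ∑ p ∈ unimodalForests n, n • f (forestRoots p).card := by
  have h : ∑ p ∈ unimodalForests n, n • f (forestRoots p).card =
      ∑ x ∈ unimodalForests n ×ˢ (Finset.univ : Finset (Fin n)), f (forestRoots x.1).card := by
    rw [Finset.sum_product]
    simp
  rw [h]
  symm
  refine Finset.sum_bij (fun x _ => insertLeaf x.1 x.2) ?_ ?_ ?_ ?_
  · rintro ⟨p, w⟩ hx
    simp only [Finset.mem_product, mem_unimodalForests, Finset.mem_univ, and_true] at hx
    simp only [Finset.mem_filter, mem_unimodalForests]
    exact ⟨isUnimodal_insertLeaf hx w, by simp [insertLeaf]⟩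
  · rintro ⟨p, w⟩ _ ⟨p', w'⟩ _ h
    have hp := congrArg deleteMin h
    simp only [deleteMin_insertLeaf] at hp
    have hw : w = w' := by simpa [insertLeaf] using congrFun h 0
    rw [hp, hw]
  · intro q hq
    simp only [Finset.mem_filter, mem_unimodalForests] at hq
    have hleaf := hq.1.zero_root_or_leaf.resolve_left hq.2
    obtain ⟨a, ha⟩ := Option.ne_none_iff_exists'.1 hq.2
    obtain ⟨w, rfl⟩ := Fin.exists_succ_eq.2 (fun h : a = 0 => hleaf 0 (h ▸ ha))
    refine ⟨(deleteMin q, w), ?_, insertLeaf_deleteMin hleaf ha⟩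
    simpa [mem_unimodalForests] using (isUnimodal_deleteMin_iff (Or.inr hleaf)).2 hq.1
  · rintro ⟨p, w⟩ _
    simp only [card_forestRoots_insertLeaf]

theorem sum_unimodalForests_root {M : Type*} [AddCommMonoid M] (n : ℕ) (f : ℕ → M) :
    ∑ q ∈ (unimodalForests (n + 1)).filter (fun q => q 0 = none), f (forestRoots q).card =
      ∑ p ∈ unimodalForests n, ∑ S ∈ (forestRoots p).powerset,
        f ((forestRoots p).card - S.card + 1) := by
  rw [Finset.sum_sigma']
  symm
  refine Finset.sum_bij (fun x _ => insertRoot x.1 x.2) ?_ ?_ ?_ ?_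
  · rintro ⟨p, S⟩ hx
    simp only [Finset.mem_sigma, mem_unimodalForests, Finset.mem_powerset] at hx
    simp only [Finset.mem_filter, mem_unimodalForests]
    exact ⟨isUnimodal_insertRoot hx.1 hx.2, by simp [insertRoot]⟩
  · rintro ⟨p, S⟩ hx ⟨p', S'⟩ hx' h
    simp only [Finset.mem_sigma, mem_unimodalForests, Finset.mem_powerset] at hx hx'
    have hp := congrArg deleteMin h
    simp only [deleteMin_insertRoot hx.2, deleteMin_insertRoot hx'.2] at hp
    subst hp
    have hS : S = S' := by
      ext i
      have hmem : ∀ T : Finset (Fin n), i ∈ T ↔ insertRoot p T i.succ = some 0 := by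
        intro T
        by_cases hi : i ∈ T <;> simp [insertRoot, hi]
      rw [hmem S, hmem S', congrFun h i.succ]
    rw [hS]
  · intro q hq
    simp only [Finset.mem_filter, mem_unimodalForests] at hq
    refine ⟨⟨deleteMin q, Finset.univ.filter fun i => q i.succ = some 0⟩, ?_,
      insertRoot_deleteMin hq.2⟩
    simp only [Finset.mem_sigma, mem_unimodalForests, Finset.mem_powerset]
    refine ⟨(isUnimodal_deleteMin_iff (Or.inl hq.2)).2 hq.1, fun i hi => ?_⟩
    simp only [Finset.mem_filter, Finset.mem_univ, true_and] at hi
    simp [forestRoots, deleteMin_eq_none, hi]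
  · rintro ⟨p, S⟩ hx
    simp only [Finset.mem_sigma, Finset.mem_powerset] at hx
    simp only [card_forestRoots_insertRoot hx.2]

theorem sum_X_pow_card_forestRoots_succ (n : ℕ) :
    ∑ q ∈ unimodalForests (n + 1), (X : ℕ[X]) ^ (forestRoots q).card =
      X * (∑ p ∈ unimodalForests n, (X : ℕ[X]) ^ (forestRoots p).card).comp (X + 1) +
        n • ∑ p ∈ unimodalForests n, (X : ℕ[X]) ^ (forestRoots p).card := by
  rw [← Finset.sum_filter_add_sum_filter_not _ (fun q => q 0 = none),
    sum_unimodalForests_root n fun k => (X : ℕ[X]) ^ k,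
    sum_unimodalForests_leaf n fun k => (X : ℕ[X]) ^ k, Finset.smul_sum, Polynomial.sum_comp,
    Finset.mul_sum]
  congr 1
  refine Finset.sum_congr rfl fun p _ => ?_
  rw [X_pow_comp, add_comm X 1, ← Finset.sum_pow_mul_eq_add_pow, Finset.mul_sum]
  refine Finset.sum_congr rfl fun S _ => ?_
  rw [one_pow, one_mul, pow_succ']

theorem sum_ascPochhammer_permNumCycles_succ (n : ℕ) :
    ∑ π : Equiv.Perm (Fin (n + 1)), ascPochhammer ℕ (permNumCycles π) =
      X * (∑ π : Equiv.Perm (Fin n), ascPochhammer ℕ (permNumCycles π)).comp (X + 1) +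
        n • ∑ π : Equiv.Perm (Fin n), ascPochhammer ℕ (permNumCycles π) := by
  rw [sum_perm_permNumCycles_succ n (ascPochhammer ℕ), Finset.sum_add_distrib, Finset.smul_sum,
    Polynomial.sum_comp, Finset.mul_sum]
  simp only [ascPochhammer_succ_left]

theorem sum_X_pow_card_forestRoots (n : ℕ) :
    ∑ p ∈ unimodalForests n, (X : ℕ[X]) ^ (forestRoots p).card =
      ∑ π : Equiv.Perm (Fin n), ascPochhammer ℕ (permNumCycles π) := by
  induction n with
  | zero =>
    have h : unimodalForests 0 = {Fin.elim0} := by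
      ext p
      simp [mem_unimodalForests, IsUnimodal, Subsingleton.elim p Fin.elim0]
    simp [h, permNumCycles_fin_zero, forestRoots]
  | succ n ih => rw [sum_X_pow_card_forestRoots_succ, sum_ascPochhammer_permNumCycles_succ, ih]

theorem count_unimodal_forests_by_trees (n m : ℕ) (hm : 1 ≤ m) (hmn : m ≤ n) :
    Nat.card {p : Fin n → Option (Fin n) //
        IsForest p ∧ ForestAvoids p [3, 1, 2] ∧ ForestAvoids p [2, 1, 3] ∧
        Nat.card {v : Fin n // p v = none} = m} =
    ∑ k ∈ Finset.Icc m n, stirlingFirst k m * stirlingFirst n k := by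
  classical
  have hroots : ∀ p : Fin n → Option (Fin n),
      Nat.card {v : Fin n // p v = none} = (forestRoots p).card := by
    intro p
    rw [Nat.card_eq_fintype_card, Fintype.card_subtype, forestRoots]
  have hiff : ∀ p : Fin n → Option (Fin n),
      (IsForest p ∧ ForestAvoids p [3, 1, 2] ∧ ForestAvoids p [2, 1, 3] ∧
        Nat.card {v : Fin n // p v = none} = m) ↔ IsUnimodal p ∧ (forestRoots p).card = m := by
    intro p
    rw [isUnimodal_iff, hroots, and_assoc, and_assoc]
  rw [← coeff_sum_ascPochhammer_permNumCycles, ← sum_X_pow_card_forestRoots, finsetSum_coeff,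
    Nat.card_congr (Equiv.subtypeEquivRight hiff), Nat.card_eq_fintype_card, Fintype.card_subtype,
    ← Finset.filter_filter, Finset.card_filter]
  simp only [coeff_X_pow, eq_comm, unimodalForests]
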